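/- Let Π=(P,L) be a connected partial linear space satisfying conditions (a)–(e) of the Setting. Define x≡y if and only if x^⊥=y^⊥; this is an equivalence relation on P. Let [x] denote the class of x, for l∈L let [l]={[x] : x∈l}, and let Π/≡=(P/≡, L/≡) where L/≡={[l] : l∈L}. Then Π/≡ is a connected partial linear space satisfying: (a) every line of Π/≡ has at least 4 points; (b) every triple of points X,Y,Z of Π/≡ with X∼Y, Y∼Z and X⊥Z is contained in a transversal plane of Π/≡; (c) for all points X,Y of Π/≡, X^⊥⊆Y^⊥ implies X=Y; (d) for every point X and every transversal plane π of Π/≡, X^⊥∩π is empty, a single point, a line, a transversal of π, or π itself; (e) Π/≡ is a linear space (any two distinct points collinear) if and only if every connected component of the graph (P,⊥) has diameter 1. -/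

import Mathlib

universe u

/-- A *partial linear space*: a set of points `P` together with a set `L` of
subsets of `P` of size at least `2` (the *lines*), such that two distinct
points lie on at most one common line. -/
structure PLS (P : Type u) where
  L : Set (Set P)
  nontrivial_lines : ∀ l ∈ L, Set.Nontrivial l
  unique_line : ∀ l ∈ L, ∀ m ∈ L, ∀ x y : P, x ≠ y →
    x ∈ l → y ∈ l → x ∈ m → y ∈ m → l = m

namespace PLS

variable {P : Type u} (S : PLS P)

/-- `x ∼ y` : the points are distinct and lie on a common line. -/
def Collinear (x y : P) : Prop := x ≠ y ∧ ∃ l ∈ S.L, x ∈ l ∧ y ∈ l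

/-- `x ⊥ y` : `x = y` or `x` and `y` are non-collinear. -/
def Perp (x y : P) : Prop := ¬ S.Collinear x y

/-- `x^⊥` : the set of points `y` with `x ⊥ y`. -/
def perpSet (x : P) : Set P := {y | S.Perp x y}

/-- Adjacency in the graph `(P, ⊥)` : distinct points with `x ⊥ y`. -/
def PerpAdj (x y : P) : Prop := x ≠ y ∧ S.Perp x y

/-- `X^⊥` for a set `X` of points: points `⊥` to every point of `X`. -/
def setPerp (X : Set P) : Set P := {z | ∀ p ∈ X, S.Perp z p}

/-- `(xy)^{⊥⊥} = {z ∈ P : z ⊥ u for every u ∈ x^⊥ ∩ y^⊥}`. -/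
def doublePerp (x y : P) : Set P :=
  {z | ∀ u ∈ S.perpSet x ∩ S.perpSet y, S.Perp z u}

/-- A subspace: every line meeting it in at least two points is contained in it. -/
def IsSubspace (X : Set P) : Prop :=
  ∀ l ∈ S.L, (∃ x ∈ l ∩ X, ∃ y ∈ l ∩ X, x ≠ y) → l ⊆ X

/-- `⟨Y⟩`, the subspace generated by `Y`. -/
def span (Y : Set P) : Set P := ⋂₀ {X | S.IsSubspace X ∧ Y ⊆ X}

/-- A plane: the subspace generated by two distinct lines meeting in a point. -/
def IsPlane (X : Set P) : Prop :=
  ∃ l ∈ S.L, ∃ m ∈ S.L, l ≠ m ∧ (l ∩ m).Nonempty ∧ X = S.span (l ∪ m)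

/-- A transversal plane: a plane `X` such that for every line `ℓ ⊆ X` the sets
`x^⊥ ∩ X`, for `x ∈ ℓ`, partition `X` (every point of `X` lies in exactly one
of them). -/
def IsTransversalPlane (X : Set P) : Prop :=
  S.IsPlane X ∧ ∀ l ∈ S.L, l ⊆ X → ∀ p ∈ X, ∃! x, x ∈ l ∧ S.Perp x p

/-- `T` is a transversal of `X`: `T = x^⊥ ∩ X` for a point `x` on a line of `X`. -/
def IsTransversalOf (T X : Set P) : Prop :=
  ∃ l ∈ S.L, l ⊆ X ∧ ∃ x ∈ l, T = S.perpSet x ∩ X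

/-- Connectedness of the collinearity graph `(P, ∼)`. -/
def Connected : Prop := ∀ x y : P, Relation.ReflTransGen S.Collinear x y

/-- Connectedness of the graph `(P, ⊥)`. -/
def CoConnected : Prop := ∀ x y : P, Relation.ReflTransGen S.PerpAdj x y

/-- The one-or-all axiom for polar spaces. -/
def IsPolar : Prop :=
  ∀ p : P, ∀ l ∈ S.L, p ∉ l →
    (∃! q, q ∈ l ∧ S.Collinear p q) ∨ (∀ q ∈ l, S.Collinear p q)

/-- Non-degeneracy: the radical is empty, i.e. no point is collinear with all
other points. -/
def Nondegenerate : Prop := ∀ p : P, ∃ q, q ≠ p ∧ ¬ S.Collinear p q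

/-- In a polar space, `p^⊥` denotes the points equal or collinear to `p`. -/
def polarPerp (x : P) : Set P := {q | q = x ∨ S.Collinear x q}

/-- `X^⊥` in a polar space, for a set of points `X`. -/
def polarPerpSet (X : Set P) : Set P := {q | ∀ x ∈ X, q ∈ S.polarPerp x}

/-- The hyperbolic line on two non-collinear points of a polar space:
`{z : z ∈ u^⊥ for every u ∈ x^⊥ ∩ y^⊥}`. -/
def polarHypLine (x y : P) : Set P :=
  {z | ∀ u ∈ S.polarPerp x ∩ S.polarPerp y, z ∈ S.polarPerp u}

/-- A linear set: any two of its distinct points are collinear. -/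
def IsLinearSet (X : Set P) : Prop := ∀ x ∈ X, ∀ y ∈ X, x ≠ y → S.Collinear x y

/-- Planarity: any two distinct lines meeting in a point are contained in a
unique plane. -/
def Planar : Prop :=
  ∀ l ∈ S.L, ∀ m ∈ S.L, l ≠ m → (l ∩ m).Nonempty →
    ∃! π, S.IsPlane π ∧ l ⊆ π ∧ m ⊆ π

/-- A projective plane: a linear space in which any two distinct lines meet in
a point, containing four points no three of which are collinear. -/
def IsProjectivePlane : Prop :=
  (∀ x y : P, x ≠ y → ∃ l ∈ S.L, x ∈ l ∧ y ∈ l) ∧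
  (∀ l ∈ S.L, ∀ m ∈ S.L, l ≠ m → (l ∩ m).Nonempty) ∧
  (∃ a b c d : P, a ≠ b ∧ a ≠ c ∧ a ≠ d ∧ b ≠ c ∧ b ≠ d ∧ c ≠ d ∧
    ∀ l ∈ S.L, ¬(a ∈ l ∧ b ∈ l ∧ c ∈ l) ∧ ¬(a ∈ l ∧ b ∈ l ∧ d ∈ l) ∧
      ¬(a ∈ l ∧ c ∈ l ∧ d ∈ l) ∧ ¬(b ∈ l ∧ c ∈ l ∧ d ∈ l))

/-- `π` is isomorphic to a dual affine plane: there is a projective plane `T`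
on a point set `Q`, a point `p` of `T`, and a bijection from `π` onto `Q ∖ {p}`
under which the lines of `Π` contained in `π` correspond exactly to the lines
of `T` not passing through `p`. -/
def IsDualAffine (π : Set P) : Prop :=
  ∃ (Q : Type u) (T : PLS Q) (p : Q) (f : P → Q),
    T.IsProjectivePlane ∧ Set.BijOn f π {q | q ≠ p} ∧
    ∀ s : Set P, s ⊆ π → (s ∈ S.L ↔ f '' s ∈ T.L ∧ p ∉ f '' s)

/-- A linear plane contains four distinct lines which pairwise meet and whose
pairwise intersection points are six distinct points. -/
def FourLinesSixPoints (π : Set P) : Prop :=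
  ∃ l : Fin 4 → Set P, (∀ i, l i ∈ S.L ∧ l i ⊆ π) ∧ Function.Injective l ∧
    ∃ pt : Fin 4 → Fin 4 → P,
      (∀ i j, i < j → pt i j ∈ l i ∩ l j) ∧
      (∀ i j k m, i < j → k < m → (i, j) ≠ (k, m) → pt i j ≠ pt k m)

/-- Conditions (a)–(d) of the Main Hypothesis, for a connected and co-connected
partial linear space:
(a) all lines have at least `4` points;
(b) `x^⊥ ⊆ y^⊥` implies `x = y`;
(c) every triple `x ∼ y ∼ z`, `x ⊥ z`, `x ≠ z`, generates a transversal plane;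
(d) for every point `p` and transversal plane `π`, `p^⊥ ∩ π` is empty, a
point, a line, or a transversal of `π`. -/
def MainHyp : Prop :=
  S.Connected ∧ S.CoConnected ∧
  (∀ l ∈ S.L, 4 ≤ Cardinal.mk ↥l) ∧
  (∀ x y : P, S.perpSet x ⊆ S.perpSet y → x = y) ∧
  (∀ x y z : P, S.Collinear x y → S.Collinear y z → S.PerpAdj x z →
    S.IsTransversalPlane (S.span {x, y, z})) ∧
  (∀ p : P, ∀ π : Set P, S.IsTransversalPlane π →
    S.perpSet p ∩ π = ∅ ∨ (∃ q, S.perpSet p ∩ π = {q}) ∨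
    S.perpSet p ∩ π ∈ S.L ∨ S.IsTransversalOf (S.perpSet p ∩ π) π)

/-- Conditions (a)–(e) of the Setting, for a connected partial linear space:
(a) all lines have at least `4` points;
(b) `x^⊥ ⊆ y^⊥` implies `x^⊥ = y^⊥`;
(c) there exist two distinct non-collinear points;
(d) every triple `x ∼ y ∼ z`, `x ⊥ z`, `x ≠ z`, is contained in a transversal
plane;
(e) for every point `p` and transversal plane `π`, `p^⊥ ∩ π` is empty, a
point, a line, a transversal of `π`, or `π` itself. -/
def Setting : Prop :=
  S.Connected ∧
  (∀ l ∈ S.L, 4 ≤ Cardinal.mk ↥l) ∧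
  (∀ x y : P, S.perpSet x ⊆ S.perpSet y → S.perpSet x = S.perpSet y) ∧
  (∃ x y : P, x ≠ y ∧ ¬ S.Collinear x y) ∧
  (∀ x y z : P, S.Collinear x y → S.Collinear y z → S.PerpAdj x z →
    ∃ π, S.IsTransversalPlane π ∧ x ∈ π ∧ y ∈ π ∧ z ∈ π) ∧
  (∀ p : P, ∀ π : Set P, S.IsTransversalPlane π →
    S.perpSet p ∩ π = ∅ ∨ (∃ q, S.perpSet p ∩ π = {q}) ∨
    S.perpSet p ∩ π ∈ S.L ∨ S.IsTransversalOf (S.perpSet p ∩ π) π ∨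
    S.perpSet p ∩ π = π)

end PLS

/-- The equivalence relation `x ≡ y ↔ x^⊥ = y^⊥` on the points. -/
def PLS.perpSetoid {P : Type u} (S : PLS P) : Setoid P :=
  ⟨fun x y => S.perpSet x = S.perpSet y,
    ⟨fun _ => rfl, Eq.symm, Eq.trans⟩⟩

namespace PLS

variable {P : Type u} {S : PLS P}

lemma col_symm {x y : P} (h : S.Collinear x y) : S.Collinear y x := by
  obtain ⟨h1, l, hl, hx, hy⟩ := h
  exact ⟨h1.symm, l, hl, hy, hx⟩

lemma perp_symm {x y : P} (h : S.Perp x y) : S.Perp y x := fun h' => h (col_symm h')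

lemma perp_self (x : P) : S.Perp x x := fun h => h.1 rfl

lemma col_mk {l : Set P} (hl : l ∈ S.L) {x y : P} (hx : x ∈ l) (hy : y ∈ l) (h : x ≠ y) :
    S.Collinear x y := ⟨h, l, hl, hx, hy⟩

lemma sub_line {π : Set P} (hπ : S.IsSubspace π) {l : Set P} (hl : l ∈ S.L) {x y : P}
    (hx : x ∈ l) (hy : y ∈ l) (h : x ≠ y) (hx' : x ∈ π) (hy' : y ∈ π) : l ⊆ π :=
  hπ l hl ⟨x, ⟨hx, hx'⟩, y, ⟨hy, hy'⟩, h⟩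

lemma span_sub (Y : Set P) : S.IsSubspace (S.span Y) := by
  intro l hl ⟨x, hx, y, hy, hxy⟩ z hz X hX
  exact sub_line hX.1 hl hx.1 hy.1 hxy (hx.2 X hX) (hy.2 X hX) hz

lemma subset_span (Y : Set P) : Y ⊆ S.span Y := fun _ hy _ hX => hX.2 hy

lemma span_le {Y X : Set P} (hX : S.IsSubspace X) (h : Y ⊆ X) : S.span Y ⊆ X :=
  fun _ hz => hz X ⟨hX, h⟩

lemma tp_sub {π : Set P} (h : S.IsTransversalPlane π) : S.IsSubspace π := by
  obtain ⟨⟨l, _, m, _, _, _, rfl⟩, _⟩ := h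
  exact span_sub _

/-- non-collinearity is transitive in a transversal plane -/
lemma tp_trans {π : Set P} (h : S.IsTransversalPlane π) {a b c : P} (ha : a ∈ π) (hb : b ∈ π)
    (hc : c ∈ π) (hab : S.Perp a b) (hbc : S.Perp b c) : S.Perp a c := by
  rintro ⟨hne, l, hl, hal, hcl⟩
  have hs := sub_line (tp_sub h) hl hal hcl hne ha hc
  exact hne ((h.2 l hl hs b hb).unique ⟨hal, hab⟩ ⟨hcl, perp_symm hbc⟩)

/-- none, one, all -/
lemma noa (h : S.Setting) {g a b c : P} {l : Set P} (hl : l ∈ S.L) (ha : a ∈ l) (hb : b ∈ l)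
    (hc : c ∈ l) (hab : a ≠ b) (h1 : S.Perp g a) (h2 : S.Perp g b) : S.Perp g c := by
  intro hgc
  by_cases hca : c = a
  · exact h1 (hca ▸ hgc)
  by_cases hga : g = a
  · subst hga; exact h2 (col_mk hl ha hb hab)
  obtain ⟨π, hπ, hg, hc', ha'⟩ :=
    h.2.2.2.2.1 g c a hgc (col_mk hl hc ha hca) ⟨hga, h1⟩
  have hs := sub_line (tp_sub hπ) hl hc ha hca hc' ha'
  exact hab ((hπ.2 l hl hs g hg).unique ⟨ha, perp_symm h1⟩ ⟨hb, perp_symm h2⟩)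

lemma equiv_perp {x x' : P} (hx : S.perpSet x = S.perpSet x') (u : P) :
    S.Perp u x ↔ S.Perp u x' := by
  have : u ∈ S.perpSet x ↔ u ∈ S.perpSet x' := by rw [hx]
  exact ⟨fun k => perp_symm (this.1 (perp_symm k)), fun k => perp_symm (this.2 (perp_symm k))⟩

lemma equiv_col {x x' : P} (hx : S.perpSet x = S.perpSet x') (u : P) :
    S.Collinear u x ↔ S.Collinear u x' := not_iff_not.1 (equiv_perp hx u)

lemma key (h : S.Setting) {x x' y z : P} {l l' : Set P} (hl : l ∈ S.L) (hl' : l' ∈ S.L)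
    (hxl : x ∈ l) (hyl : y ∈ l) (hzl : z ∈ l) (hxl' : x' ∈ l') (hyl' : y ∈ l')
    (hxy : x ≠ y) (hx'y : x' ≠ y)
    (hxx : S.perpSet x = S.perpSet x') : ∃ z' ∈ l', S.perpSet z = S.perpSet z' := by
  by_cases hxx' : x = x'
  · subst hxx'
    have := S.unique_line l hl l' hl' x y hxy hxl hyl hxl' hyl'
    exact ⟨z, this ▸ hzl, rfl⟩
  by_cases hzy : z = y
  · exact ⟨y, hyl', by rw [hzy]⟩
  have hpxx : S.Perp x x' := (equiv_perp hxx x).1 (perp_self x)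
  have cxy : S.Collinear x y := col_mk hl hxl hyl hxy
  have cx'y : S.Collinear x' y := col_mk hl' hxl' hyl' hx'y
  obtain ⟨π, hπ, hxπ, hyπ, hx'π⟩ := h.2.2.2.2.1 x y x' cxy (col_symm cx'y) ⟨hxx', hpxx⟩
  have hlπ := sub_line (tp_sub hπ) hl hxl hyl hxy hxπ hyπ
  have hl'π := sub_line (tp_sub hπ) hl' hxl' hyl' hx'y hx'π hyπ
  obtain ⟨z', ⟨hz'l, hz'z⟩, hz'u⟩ := hπ.2 l' hl' hl'π z (hlπ hzl)
  refine ⟨z', hz'l, h.2.2.1 _ _ ?_⟩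
  intro u hzu
  by_contra huz'
  have huz' : S.Collinear z' u := not_not.1 huz'
  have hzu : S.Perp z u := hzu
  have huπ : u ∉ π := fun hu => tp_trans hπ (hl'π hz'l) (hlπ hzl) hu hz'z hzu huz'
  have bad1 : ¬ (∀ w ∈ l, S.Perp u w) := by
    intro hw
    exact noa h hl' hxl' hyl' hz'l hx'y ((equiv_perp hxx u).1 (hw x hxl)) (hw y hyl)
      (col_symm huz')
  have cuy : S.Collinear u y := by
    by_contra hc
    exact bad1 fun w hw => noa h hl hzl hyl hw hzy (perp_symm hzu) hc
  have huz : u ≠ z := fun hh => huπ (hh ▸ hlπ hzl)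
  obtain ⟨ρ, hρ, huρ, hyρ, hzρ⟩ := h.2.2.2.2.1 u y z cuy
    (col_mk hl hyl hzl (Ne.symm hzy)) ⟨huz, perp_symm hzu⟩
  obtain ⟨huy, k, hk, huk, hyk⟩ := cuy
  have hlρ := sub_line (tp_sub hρ) hl hyl hzl (Ne.symm hzy) hyρ hzρ
  have hkρ := sub_line (tp_sub hρ) hk huk hyk huy huρ hyρ
  obtain ⟨t, ⟨htk, htx⟩, -⟩ := hρ.2 k hk hkρ x (hlρ hxl)
  have htx' : S.Perp t x' := (equiv_perp hxx t).1 htx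
  have hty : y ≠ t := by
    rintro rfl; exact htx (col_symm cxy)
  have hkπ : ∀ w ∈ k, w ≠ y → w ∉ π := fun w hw hwy hwπ =>
    huπ (sub_line (tp_sub hπ) hk hw hyk hwy hwπ hyπ huk)
  have htπ : t ∉ π := hkπ t htk (Ne.symm hty)
  obtain ⟨τ, hτ, hx'τ, hyτ, htτ⟩ := h.2.2.2.2.1 x' y t cx'y (col_mk hk hyk htk hty)
    ⟨fun hh => htπ (hh ▸ hx'π), perp_symm htx'⟩
  have hkτ := sub_line (tp_sub hτ) hk hyk htk hty hyτ htτ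
  have hl'τ := sub_line (tp_sub hτ) hl' hxl' hyl' hx'y hx'τ hyτ
  obtain ⟨z2, ⟨hz2l, hz2u⟩, -⟩ := hτ.2 l' hl' hl'τ u (hkτ huk)
  have cz2 : S.Collinear z2 z := by
    by_contra hc
    have := hz'u z2 ⟨hz2l, hc⟩
    subst this
    exact hz2u huz'
  obtain ⟨hz2z, n, hn, hz2n, hzn⟩ := cz2
  have hnπ := sub_line (tp_sub hπ) hn hz2n hzn hz2z (hl'π hz2l) (hlπ hzl)
  obtain ⟨g, ⟨hgn, hgx⟩, -⟩ := hπ.2 n hn hnπ x hxπ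
  have hug : S.Perp u g := noa h hn hz2n hzn hgn hz2z (perp_symm hz2u) (perp_symm hzu)
  have hgπ := hnπ hgn
  have htg : S.Perp t g := by
    have mx : x ∈ S.perpSet t ∩ π := ⟨htx, hxπ⟩
    have mx' : x' ∈ S.perpSet t ∩ π := ⟨htx', hx'π⟩
    rcases h.2.2.2.2.2 t π hπ with e | ⟨q, e⟩ | e | ⟨a, ha, haπ, w, hw, e⟩ | e
    · rw [e] at mx; exact mx.elim
    · rw [e] at mx mx'; exact (hxx' (mx.trans mx'.symm)).elim
    · exact (hpxx (col_mk e mx mx' hxx')).elim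
    · have : g ∈ S.perpSet t ∩ π := by
        rw [e] at mx ⊢
        exact ⟨tp_trans hπ (haπ hw) hxπ hgπ mx.1 (perp_symm hgx), hgπ⟩
      exact this.1
    · rw [← e] at hgπ; exact hgπ.1
  have htu : t ≠ u := by
    rintro rfl
    -- t = u would be non-collinear with x and z on l
    by_cases hzx : z = x
    · subst hzx
      have e : x' = z' := hz'u x' ⟨hxl', perp_symm hpxx⟩
      subst e
      exact htx' (col_symm huz')
    · exact bad1 fun w hw => noa h hl hzl hxl hw hzx (perp_symm hzu) htx
  have hgy : S.Perp g y := noa h hk htk huk hyk htu (perp_symm htg) (perp_symm hug)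
  exact tp_trans hπ hxπ hgπ hyπ (perp_symm hgx) hgy cxy

/-- class map -/
abbrev cl (S : PLS P) (x : P) : Quotient S.perpSetoid := Quotient.mk S.perpSetoid x

lemma cl_eq {x y : P} : S.cl x = S.cl y ↔ S.perpSet x = S.perpSet y := Quotient.eq

lemma cl_ne_of_col {x y : P} (h : S.Collinear x y) : S.cl x ≠ S.cl y := fun e =>
  (equiv_perp (cl_eq.1 e) x).1 (perp_self x) h

lemma cl_inj {l : Set P} (hl : l ∈ S.L) : Set.InjOn S.cl l := by
  intro a ha b hb hab
  by_contra hne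
  exact cl_ne_of_col (col_mk hl ha hb hne) hab

lemma line_eq_step (h : S.Setting) {x x' y : P} {l l' : Set P} (hl : l ∈ S.L) (hl' : l' ∈ S.L)
    (hxl : x ∈ l) (hyl : y ∈ l) (hxl' : x' ∈ l') (hyl' : y ∈ l')
    (hxy : S.cl x ≠ S.cl y) (hxx : S.cl x = S.cl x') : S.cl '' l = S.cl '' l' := by
  have h1 : x ≠ y := fun e => hxy (by rw [e])
  have h2 : x' ≠ y := fun e => hxy (by rw [hxx, e])
  apply Set.Subset.antisymm
  · rintro _ ⟨z, hz, rfl⟩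
    obtain ⟨z', hz', e⟩ := key h hl hl' hxl hyl hz hxl' hyl' h1 h2 (cl_eq.1 hxx)
    exact ⟨z', hz', (cl_eq.2 e).symm⟩
  · rintro _ ⟨z, hz, rfl⟩
    obtain ⟨z', hz', e⟩ := key h hl' hl hxl' hyl' hz hxl hyl h2 h1 (cl_eq.1 hxx).symm
    exact ⟨z', hz', (cl_eq.2 e).symm⟩

lemma line_eq (h : S.Setting) {x x' y y' : P} {l l' : Set P} (hl : l ∈ S.L) (hl' : l' ∈ S.L)
    (hxl : x ∈ l) (hyl : y ∈ l) (hxl' : x' ∈ l') (hyl' : y' ∈ l')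
    (hxy : S.cl x ≠ S.cl y) (hxx : S.cl x = S.cl x') (hyy : S.cl y = S.cl y') :
    S.cl '' l = S.cl '' l' := by
  have c : S.Collinear x y := col_mk hl hxl hyl (fun e => hxy (by rw [e]))
  obtain ⟨-, k, hk, hyk, hxk⟩ := (equiv_col (cl_eq.1 hxx) y).1 (col_symm c)
  rw [line_eq_step h hl hk hxl hyl hxk hyk hxy hxx]
  exact line_eq_step h hk hl' hyk hxk hyl' hxl' (by rw [← hxx]; exact hxy.symm) hyy

/-- the quotient space -/
def quot (S : PLS P) (h : S.Setting) : PLS (Quotient S.perpSetoid) where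
  L := {m | ∃ l ∈ S.L, m = Quotient.mk S.perpSetoid '' l}
  nontrivial_lines := by
    rintro _ ⟨l, hl, rfl⟩
    exact (S.nontrivial_lines l hl).image_of_injOn (cl_inj hl)
  unique_line := by
    rintro _ ⟨l, hl, rfl⟩ _ ⟨m, hm, rfl⟩ X Y hXY ⟨x, hx, rfl⟩ ⟨y, hy, rfl⟩ ⟨x', hx', ex⟩
      ⟨y', hy', ey⟩
    exact line_eq h hl hm hx hy hx' hy' hXY ex.symm ey.symm

variable (h : S.Setting)

lemma quot_line {l : Set P} (hl : l ∈ S.L) : S.cl '' l ∈ (S.quot h).L := ⟨l, hl, rfl⟩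

lemma quot_col {x y : P} : (S.quot h).Collinear (S.cl x) (S.cl y) ↔ S.Collinear x y := by
  constructor
  · rintro ⟨hne, _, ⟨l, hl, rfl⟩, ⟨x', hx', ex⟩, ⟨y', hy', ey⟩⟩
    have c : S.Collinear x' y' := col_mk hl hx' hy' (by
      rintro rfl
      exact hne (ex.symm.trans ey))
    have c2 := (equiv_col (cl_eq.1 ey) x').1 c
    exact col_symm ((equiv_col (cl_eq.1 ex) y).1 (col_symm c2))
  · intro c
    obtain ⟨hne, l, hl, hx, hy⟩ := id c
    exact ⟨cl_ne_of_col c, _, quot_line h hl, ⟨x, hx, rfl⟩, ⟨y, hy, rfl⟩⟩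

lemma quot_perp {x y : P} : (S.quot h).Perp (S.cl x) (S.cl y) ↔ S.Perp x y :=
  not_congr (quot_col h)

/-- lifting a quotient line to a line inside a subspace -/
lemma lift_line {π : Set P} (hπ : S.IsSubspace π) {N : Set (Quotient S.perpSetoid)}
    (hN : N ∈ (S.quot h).L) {a b : P} (ha : a ∈ π) (hb : b ∈ π) (hab : S.cl a ≠ S.cl b)
    (haN : S.cl a ∈ N) (hbN : S.cl b ∈ N) : ∃ n ∈ S.L, n ⊆ π ∧ N = S.cl '' n := by
  obtain ⟨hne, n, hn, han, hbn⟩ := (quot_col h).1 ⟨hab, N, hN, haN, hbN⟩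
  exact ⟨n, hn, sub_line hπ hn han hbn hne ha hb,
    (S.quot h).unique_line N hN _ (quot_line h hn) _ _ hab haN hbN ⟨a, han, rfl⟩ ⟨b, hbn, rfl⟩⟩

lemma lift_line' {π : Set P} (hπ : S.IsSubspace π) {N : Set (Quotient S.perpSetoid)}
    (hN : N ∈ (S.quot h).L) (hNπ : N ⊆ S.cl '' π) : ∃ n ∈ S.L, n ⊆ π ∧ N = S.cl '' n := by
  obtain ⟨A, hA, B, hB, hAB⟩ := (S.quot h).nontrivial_lines N hN
  obtain ⟨a, ha, rfl⟩ := hNπ hA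
  obtain ⟨b, hb, rfl⟩ := hNπ hB
  exact lift_line h hπ hN ha hb hAB hA hB

lemma image_sub {π : Set P} (hπ : S.IsSubspace π) : (S.quot h).IsSubspace (S.cl '' π) := by
  rintro N hN ⟨_, ⟨hA, a, ha, rfl⟩, _, ⟨hB, b, hb, rfl⟩, hAB⟩
  obtain ⟨n, hn, hnπ, rfl⟩ := lift_line h hπ hN ha hb hAB hA hB
  exact Set.image_mono hnπ

lemma preimage_sub {X : Set (Quotient S.perpSetoid)} (hX : (S.quot h).IsSubspace X) :
    S.IsSubspace (S.cl ⁻¹' X) := by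
  rintro l hl ⟨x, ⟨hx, hxX⟩, y, ⟨hy, hyX⟩, hxy⟩ z hz
  exact hX _ (quot_line h hl) ⟨_, ⟨⟨x, hx, rfl⟩, hxX⟩, _, ⟨⟨y, hy, rfl⟩, hyX⟩,
    cl_ne_of_col (col_mk hl hx hy hxy)⟩ ⟨z, hz, rfl⟩

lemma image_span (Y : Set P) : S.cl '' (S.span Y) = (S.quot h).span (S.cl '' Y) := by
  apply Set.Subset.antisymm
  · rw [Set.image_subset_iff]
    exact span_le (preimage_sub h (span_sub _)) (fun y hy => subset_span _ ⟨y, hy, rfl⟩)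
  · exact span_le (image_sub h (span_sub _)) (Set.image_mono (subset_span _))

lemma line_sub {l : Set P} (hl : l ∈ S.L) : S.IsSubspace l := by
  rintro m hm ⟨x, hx, y, hy, hxy⟩
  rw [S.unique_line m hm l hl x y hxy hx.1 hy.1 hx.2 hy.2]

lemma image_tp {π : Set P} (hπ : S.IsTransversalPlane π) {x z : P} (hx : x ∈ π) (hz : z ∈ π)
    (hxz : S.Perp x z) (hne : S.cl x ≠ S.cl z) : (S.quot h).IsTransversalPlane (S.cl '' π) := by
  have hsub := tp_sub hπ
  refine ⟨?_, ?_⟩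
  · obtain ⟨⟨l, hl, m, hm, hlm, ⟨p, hp⟩, rfl⟩, -⟩ := hπ
    refine ⟨_, quot_line h hl, _, quot_line h hm, ?_, ⟨S.cl p, ⟨p, hp.1, rfl⟩, ⟨p, hp.2, rfl⟩⟩, ?_⟩
    · intro e
      have : S.span (l ∪ m) ⊆ S.cl ⁻¹' (S.cl '' l) := by
        apply span_le (preimage_sub h (line_sub (quot_line h hl)))
        rw [Set.union_subset_iff, ← Set.image_subset_iff, ← Set.image_subset_iff, ← e]
        exact ⟨subset_rfl, subset_rfl⟩
      exact (quot_perp h).2 hxz ⟨hne, _, quot_line h hl, this hx, this hz⟩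
    · rw [← Set.image_union, image_span]
  · intro N hN hNπ P' hP'
    obtain ⟨n, hn, hnπ, rfl⟩ := lift_line' h hsub hN hNπ
    obtain ⟨p, hp, rfl⟩ := hP'
    obtain ⟨w, ⟨hw, hwp⟩, hu⟩ := hπ.2 n hn hnπ p hp
    refine ⟨S.cl w, ⟨⟨w, hw, rfl⟩, (quot_perp h).2 hwp⟩, ?_⟩
    rintro _ ⟨⟨v, hv, rfl⟩, hvp⟩
    rw [hu v ⟨hv, (quot_perp h).1 hvp⟩]

lemma lift_tp {X : Set (Quotient S.perpSetoid)} (hX : (S.quot h).IsTransversalPlane X) :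
    ∃ π, S.IsTransversalPlane π ∧ X = S.cl '' π := by
  obtain ⟨⟨_, ⟨l, hl, rfl⟩, _, ⟨m, hm, rfl⟩, hlm, ⟨_, ⟨y, hy, rfl⟩, ⟨y', hy', e⟩⟩, hXs⟩, ht⟩ := hX
  obtain ⟨w, hw, hwy⟩ := (S.nontrivial_lines m hm).exists_ne y'
  have c := (equiv_col (cl_eq.1 e) w).1 (col_mk hm hw hy' hwy)
  obtain ⟨-, k, hk, hwk, hyk⟩ := id c
  have ek : S.cl '' m = S.cl '' k :=
    line_eq h hm hk hw hy' hwk hyk (cl_ne_of_col (col_mk hm hw hy' hwy)) rfl e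
  have eX : X = S.cl '' (S.span (l ∪ k)) := by
    rw [image_span h, Set.image_union, ← ek]; exact hXs
  refine ⟨S.span (l ∪ k), ⟨⟨l, hl, k, hk, ?_, ⟨y, hy, hyk⟩, rfl⟩, ?_⟩, eX⟩
  · rintro rfl
    exact hlm ek.symm
  · intro n hn hnπ p hp
    obtain ⟨_, ⟨⟨v, hv, rfl⟩, hvp⟩, hu⟩ := ht _ (quot_line h hn)
      (by rw [eX]; exact Set.image_mono hnπ) (S.cl p) (by rw [eX]; exact ⟨p, hp, rfl⟩)
    refine ⟨v, ⟨hv, (quot_perp h).1 hvp⟩, ?_⟩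
    rintro v' ⟨hv', hp'⟩
    exact cl_inj hn hv' hv (hu _ ⟨⟨v', hv', rfl⟩, (quot_perp h).2 hp'⟩)

lemma image_perp (p : P) (π : Set P) :
    (S.quot h).perpSet (S.cl p) ∩ S.cl '' π = S.cl '' (S.perpSet p ∩ π) := by
  ext Q
  constructor
  · rintro ⟨h1, q, hq, rfl⟩
    exact ⟨q, ⟨(quot_perp h).1 h1, hq⟩, rfl⟩
  · rintro ⟨q, ⟨h1, hq⟩, rfl⟩
    exact ⟨(quot_perp h).2 h1, q, hq, rfl⟩

end PLS

/-- Reduction Theorem 3.11. In the Setting, the quotient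
`Π/≡ = (P/≡, L/≡)` is a connected partial linear space with lines of at least
`4` points, in which every triple `X ∼ Y ∼ Z`, `X ⊥ Z` (with `X ≠ Z`), lies
in a transversal plane, `X^⊥ ⊆ Y^⊥` implies `X = Y`, the intersection of a
point's perp with a transversal plane is empty, a point, a line, a
transversal, or the whole plane, and `Π/≡` is linear iff every connected
component of `(P, ⊥)` has diameter `1`. -/
theorem reduction_theorem {P : Type u} (S : PLS P) (h : S.Setting) :
    ∃ T : PLS (Quotient S.perpSetoid),
      T.L = {m | ∃ l ∈ S.L, m = Quotient.mk S.perpSetoid '' l} ∧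
      T.Connected ∧
      (∀ l ∈ T.L, 4 ≤ Cardinal.mk ↥l) ∧
      (∀ X Y Z, T.Collinear X Y → T.Collinear Y Z → T.PerpAdj X Z →
        ∃ π, T.IsTransversalPlane π ∧ X ∈ π ∧ Y ∈ π ∧ Z ∈ π) ∧
      (∀ X Y, T.perpSet X ⊆ T.perpSet Y → X = Y) ∧
      (∀ X, ∀ π, T.IsTransversalPlane π →
        T.perpSet X ∩ π = ∅ ∨ (∃ q, T.perpSet X ∩ π = {q}) ∨
        T.perpSet X ∩ π ∈ T.L ∨ T.IsTransversalOf (T.perpSet X ∩ π) π ∨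
        T.perpSet X ∩ π = π) ∧
      ((∀ X Y : Quotient S.perpSetoid, X ≠ Y → T.Collinear X Y) ↔
        (∀ x a b : P, Relation.ReflTransGen S.PerpAdj x a →
          Relation.ReflTransGen S.PerpAdj x b → S.Perp a b)) := by
  refine ⟨S.quot h, rfl, ?_, ?_, ?_, ?_, ?_, ?_⟩
  · intro X Y
    induction X using Quotient.inductionOn with | _ x
    induction Y using Quotient.inductionOn with | _ y
    exact (h.1 x y).lift S.cl (fun a b hab => (PLS.quot_col h).2 hab)
  · rintro _ ⟨l, hl, rfl⟩
    have := Cardinal.mk_image_eq_of_injOn S.cl l (PLS.cl_inj hl)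
    exact (h.2.1 l hl).trans this.ge
  · intro X Y Z hXY hYZ hXZ
    induction X using Quotient.inductionOn with | _ x
    induction Y using Quotient.inductionOn with | _ y
    induction Z using Quotient.inductionOn with | _ z
    have hp : S.Perp x z := (PLS.quot_perp h).1 hXZ.2
    obtain ⟨π, hπ, hx, hy, hz⟩ := h.2.2.2.2.1 x y z ((PLS.quot_col h).1 hXY)
      ((PLS.quot_col h).1 hYZ) ⟨fun e => hXZ.1 (by rw [e]), hp⟩
    exact ⟨_, PLS.image_tp h hπ hx hz hp hXZ.1, ⟨x, hx, rfl⟩, ⟨y, hy, rfl⟩, ⟨z, hz, rfl⟩⟩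
  · intro X Y hXY
    induction X using Quotient.inductionOn with | _ x
    induction Y using Quotient.inductionOn with | _ y
    refine PLS.cl_eq.2 (h.2.2.1 x y fun u hu => ?_)
    exact (PLS.quot_perp h).1 (hXY (show S.cl u ∈ _ from (PLS.quot_perp h).2 hu))
  · intro X π' hπ'
    induction X using Quotient.inductionOn with | _ p
    obtain ⟨π, hπ, rfl⟩ := PLS.lift_tp h hπ'
    have e0 := PLS.image_perp h p π
    rw [e0]
    rcases h.2.2.2.2.2 p π hπ with e | ⟨q, e⟩ | e | ⟨a, ha, haπ, w, hw, e⟩ | e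
    · left; rw [e, Set.image_empty]
    · right; left; exact ⟨S.cl q, by rw [e, Set.image_singleton]⟩
    · right; right; left; exact PLS.quot_line h e
    · right; right; right; left
      exact ⟨_, PLS.quot_line h ha, Set.image_mono haπ, S.cl w, ⟨w, hw, rfl⟩, by
        rw [e, PLS.image_perp h w π]⟩
    · right; right; right; right; rw [e]
  · constructor
    · intro hlin x a b hxa hxb
      have hq : ∀ c, Relation.ReflTransGen S.PerpAdj x c → S.cl x = S.cl c := by
        intro c hc
        induction hc with
        | refl => rfl
        | tail _ hbc ih =>
          rw [ih]
          by_contra hne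
          exact hbc.2 ((PLS.quot_col h).1 (hlin _ _ hne))
      have : S.cl a = S.cl b := (hq a hxa).symm.trans (hq b hxb)
      exact (PLS.equiv_perp (PLS.cl_eq.1 this) a).1 (PLS.perp_self a)
    · intro hd X Y hXY
      induction X using Quotient.inductionOn with | _ x
      induction Y using Quotient.inductionOn with | _ y
      have hr : ∀ c, S.Perp x c → Relation.ReflTransGen S.PerpAdj x c := by
        intro c hc
        by_cases e : x = c
        · rw [e]
        · exact .single ⟨e, hc⟩
      refine (PLS.quot_col h).2 ?_
      by_contra hp
      exact hXY (PLS.cl_eq.2 (h.2.2.1 x y fun u hu => hd x y u (hr y hp) (hr u hu)))
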